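/- Let T, Q, Z be finite sets and suppose (u, v) is a dual pair of graded bases of Λ_ℚ. Let A be a T×Q-matrix and B a Q×Z-matrix over ℚ. Then (AB)^≀(u,v) = A^≀(u,v) · B^≀(u,v). -/

import Mathlib

open scoped BigOperators
open Classical

noncomputable section

/-- The number of maps `f` from the (indexed) parts of `mu` to the parts of `lam` such that for
every part `lam_i` of `lam`, the sum of the parts of `mu` in the fibre `f⁻¹(i)` equals `lam_i`.
This is `|𝓜_{λμ}|` and also the value of the permutation character `h_λ` on the class of cycle
type `μ`. -/
def Mcount (lam mu : Multiset ℕ) : ℕ :=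
  Fintype.card {f : Fin (Multiset.card mu) → Fin (Multiset.card lam) //
    ∀ i : Fin (Multiset.card lam),
      (∑ j ∈ Finset.univ.filter (fun j => f j = i), (mu.sort (· ≤ ·)).getD j 0)
        = (lam.sort (· ≤ ·)).getD i 0}

/-- `z_λ = ∏_i i^{m_i(λ)} m_i(λ)!`. -/
def zMult (lam : Multiset ℕ) : ℕ :=
  ∏ i ∈ lam.toFinset, i ^ lam.count i * (lam.count i).factorial

/-- The cycle type of a permutation of `Fin n`, as the multiset of parts of a partition of `n`
(including the parts equal to `1` corresponding to fixed points). -/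
def cycM {n : ℕ} (g : Equiv.Perm (Fin n)) : Multiset ℕ :=
  g.cycleType + Multiset.replicate (n - g.support.card) 1

/-- The value of the irreducible character `s_λ` of the symmetric group on the conjugacy class
of cycle type `nu`, given by the Jacobi–Trudi determinant `s_λ = det(h_{λ_i - i + j})_{i,j}`,
where `h_α` has value `Mcount α ν` on the class of cycle type `ν`. -/
def sval (lam nu : Multiset ℕ) : ℚ :=
  let L := (lam.sort (· ≤ ·)).reverse
  let l := Multiset.card lam
  ∑ σ : Equiv.Perm (Fin l),
    ((Equiv.Perm.sign σ : ℤ) : ℚ) *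
      (if ∀ i : Fin l, (i : ℕ) ≤ L.getD i 0 + (σ i : ℕ) then
        (Mcount ((Multiset.map (fun i : Fin l => L.getD i 0 + (σ i : ℕ) - (i : ℕ))
            (Finset.univ.val : Multiset (Fin l))).filter (fun x => x ≠ 0)) nu : ℚ)
       else 0)

/-- The irreducible character of `S_n` labelled by the partition `lam`, as a class function on
the symmetric group `S_n = Perm (Fin n)`. -/
def sFun {n : ℕ} (lam : Nat.Partition n) : Equiv.Perm (Fin n) → ℚ :=
  fun g => sval lam.parts (cycM g)

/-- The usual scalar product of class functions on a finite group:
`⟨f, h⟩ = |G|⁻¹ ∑_{g ∈ G} f(g) h(g⁻¹)`. -/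
def sp {G : Type*} [Group G] [Fintype G] (f h : G → ℚ) : ℚ :=
  (Fintype.card G : ℚ)⁻¹ * ∑ g : G, f g * h g⁻¹

/-- The class function `p_λ` on `S_w`: `p_λ(g_μ) = z_λ δ_{λμ}`. -/
def pFun {w : ℕ} (lam : Nat.Partition w) : Equiv.Perm (Fin w) → ℚ :=
  fun g => if cycM g = lam.parts then (zMult lam.parts : ℚ) else 0

/-- The class function `p̃_λ = z_λ⁻¹ p_λ` on `S_w`: the indicator of the class of type `λ`. -/
def ptFun {w : ℕ} (lam : Nat.Partition w) : Equiv.Perm (Fin w) → ℚ :=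
  fun g => if cycM g = lam.parts then 1 else 0

/-- The induced class function along an injection `ι : H → G` (underlying a subgroup inclusion):
`Ind φ (g) = |H|⁻¹ ∑_{x ∈ G} ∑_{h ∈ H, ι(h) = x g x⁻¹} φ(h)`. -/
def IndFun {H G : Type*} [Fintype H] [Fintype G] [Group G] (ι : H → G) (φ : H → ℚ) :
    G → ℚ :=
  fun g => (Fintype.card H : ℚ)⁻¹ * ∑ x : G, ∑ h : H, if ι h = x * g * x⁻¹ then φ h else 0

/-- A bijection `Σ_i Fin (w_i) ≃ Fin w` when `∑_i w_i = w`, realising `Fin w` as the disjoint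
union of blocks of sizes `w_i`. -/
def embSigma {η : Type*} [Fintype η] (ws : η → ℕ) {w : ℕ} (h : ∑ i, ws i = w) :
    (Σ i, Fin (ws i)) ≃ Fin w :=
  Fintype.equivOfCardEq (by simp [h])

/-- The type of all partitions (of arbitrary natural numbers). -/
abbrev PttAll : Type := Σ n : ℕ, Nat.Partition n

/-- Partitions of size at most `w`, with bounded first component (a finite type). -/
abbrev PBP (w : ℕ) : Type := (m : Fin (w + 1)) × Nat.Partition m

/-- `PMap_w(T)`: the (finite) set of maps from `T` to partitions, of total size `w`. -/
abbrev PMapw (T : Type*) [Fintype T] (w : ℕ) : Type _ :=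
  {lam : T → PBP w // ∑ t, ((lam t).1 : ℕ) = w}

/-- The scalar product on `Λ_ℚ = ⊕_w CF(S_w)` of two graded elements (the graded components
being orthogonal, this is zero when the degrees differ). -/
def pairCF {a b : ℕ} (f : Equiv.Perm (Fin a) → ℚ) (g : Equiv.Perm (Fin b) → ℚ) : ℚ :=
  if h : a = b then sp f (fun σ => g ((finCongr h).permCongr σ)) else 0

/-- The product in `Λ_ℚ` of a finite family of graded class functions: the class function on
`S_w` induced from the outer tensor product on the Young subgroup `∏_i S_{w_i}`. -/
def multiProdCF {η : Type*} [Fintype η] (ws : η → ℕ) {w : ℕ} (h : ∑ i, ws i = w)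
    (fs : ∀ i, Equiv.Perm (Fin (ws i)) → ℚ) : Equiv.Perm (Fin w) → ℚ :=
  IndFun (fun (g : ∀ i, Equiv.Perm (Fin (ws i))) =>
      ((embSigma ws h).symm.trans
        ((Equiv.sigmaCongrRight (fun i => (g i : Fin (ws i) ≃ Fin (ws i)))).trans
          (embSigma ws h)) : Equiv.Perm (Fin w)))
    (fun g => ∏ i, fs i (g i))

/-- The `ℚ`-subspace of class functions on `S_n`. -/
def classFunSub (n : ℕ) : Submodule ℚ (Equiv.Perm (Fin n) → ℚ) where
  carrier := {f | ∀ x g, f (x * g * x⁻¹) = f g}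
  add_mem' := by
    intro f g hf hg x y
    simp only [Pi.add_apply, hf x y, hg x y]
  zero_mem' := by intro x y; rfl
  smul_mem' := by
    intro c f hf x y
    simp only [Pi.smul_apply, hf x y]

/-- A graded basis of `Λ_ℚ = ⊕_w CF(S_w)`: a family `(u_λ)` such that for each `n`, the
`u_λ`, `λ ⊢ n`, form a `ℚ`-basis of the space of class functions on `S_n`. -/
def IsGradedBasis (u : ∀ n : ℕ, Nat.Partition n → Equiv.Perm (Fin n) → ℚ) : Prop :=
  ∀ n : ℕ, (∀ lam, u n lam ∈ classFunSub n) ∧ LinearIndependent ℚ (u n) ∧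
    Submodule.span ℚ (Set.range (u n)) = classFunSub n

/-- `(u, v)` is a dual pair of graded bases: `⟨u_λ, v_μ⟩ = δ_{λμ}`. -/
def IsDualPair (u v : ∀ n : ℕ, Nat.Partition n → Equiv.Perm (Fin n) → ℚ) : Prop :=
  ∀ (n : ℕ) (lam mu : Nat.Partition n), sp (u n lam) (v n mu) = if lam = mu then 1 else 0

/-- The `(λ̲, μ̲)`-entry of the matrix `A^{≀}(u, v)`:
`∑_{ν̲} (∏_t ⟨u_{λ̲(t)}, ∏_q p̃_{ν̲(t,q)}⟩) (∏_q ⟨v_{μ̲(q)}, ∏_t p_{ν̲(t,q)}⟩)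
  (∏_{t,q} A_{tq}^{l(ν̲(t,q))})`,
the sum running over all maps `ν̲` from `T × Q` to partitions. -/
def wrGen {T Q : Type*} [Fintype T] [Fintype Q]
    (u v : ∀ n : ℕ, Nat.Partition n → Equiv.Perm (Fin n) → ℚ)
    (A : T → Q → ℚ) (lam : T → PttAll) (mu : Q → PttAll) : ℚ :=
  ∑ᶠ nu : T × Q → PttAll,
    (∏ t : T, pairCF (u (lam t).1 (lam t).2)
        (multiProdCF (fun q => (nu (t, q)).1) rfl (fun q => ptFun (nu (t, q)).2))) *
    (∏ q : Q, pairCF (v (mu q).1 (mu q).2)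
        (multiProdCF (fun t => (nu (t, q)).1) rfl (fun t => pFun (nu (t, q)).2))) *
    (∏ t : T, ∏ q : Q, A t q ^ (Multiset.card (nu (t, q)).2.parts))

theorem ct_permCongr {α β : Type*} [Fintype α] [Fintype β] [DecidableEq α] [DecidableEq β]
    (e : α ≃ β) (g : Equiv.Perm α) : (e.permCongr g).cycleType = g.cycleType := by
  rw [← Equiv.Perm.cycleType_extendDomain (e.trans (Equiv.Set.univ β).symm) (g := g)]
  congr 1

theorem sum_cycM {n : ℕ} (g : Equiv.Perm (Fin n)) : (cycM g).sum = n := by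
  have := g.partition.parts_sum
  simpa [Equiv.Perm.partition, cycM] using this

theorem pos_cycM {n : ℕ} (g : Equiv.Perm (Fin n)) {i : ℕ} (h : i ∈ cycM g) : 0 < i := by
  apply g.partition.parts_pos
  simpa [Equiv.Perm.partition, cycM] using h

theorem cycM_inv {n : ℕ} (g : Equiv.Perm (Fin n)) : cycM g⁻¹ = cycM g := by
  simp [cycM, Equiv.Perm.cycleType_inv]

theorem filter_cycM {n : ℕ} (g : Equiv.Perm (Fin n)) :
    (cycM g).filter (2 ≤ ·) = g.cycleType := by
  have := Equiv.Perm.filter_parts_partition_eq_cycleType (σ := g)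
  simpa [Equiv.Perm.partition, cycM] using this

theorem isConj_of_cycM {n : ℕ} {g h : Equiv.Perm (Fin n)} (e : cycM g = cycM h) : IsConj g h := by
  apply Equiv.Perm.isConj_of_cycleType_eq
  rw [← filter_cycM, ← filter_cycM, e]

theorem cycM_eq_iff {n : ℕ} (g : Equiv.Perm (Fin n)) (lam : Nat.Partition n) :
    cycM g = lam.parts ↔ g.cycleType = lam.parts.filter (2 ≤ ·) := by
  constructor
  · intro h; rw [← h, filter_cycM]
  · intro h
    have h1 : ∀ m : Multiset ℕ, (∀ i ∈ m, 0 < i) →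
        m = m.filter (2 ≤ ·) + Multiset.replicate (m.sum - (m.filter (2 ≤ ·)).sum) 1 := by
      intro m hm
      have h2 : m.filter (fun i => ¬ 2 ≤ i) = Multiset.replicate
          (Multiset.card (m.filter (fun i => ¬ 2 ≤ i))) 1 := by
        rw [Multiset.eq_replicate]
        refine ⟨rfl, fun b hb => ?_⟩
        rw [Multiset.mem_filter] at hb
        have := hm b hb.1
        omega
      have h3 := Multiset.filter_add_not (2 ≤ ·) m
      have h4 : m.sum = (m.filter (2 ≤ ·)).sum + Multiset.card (m.filter (fun i => ¬ 2 ≤ i)) := by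
        conv_lhs => rw [← h3, h2]
        simp
      rw [h4, Nat.add_sub_cancel_left, ← h2, h3]
    rw [h1 lam.parts (fun i hi => lam.parts_pos hi), h1 (cycM g) (fun i hi => pos_cycM g hi),
      filter_cycM, h, sum_cycM, lam.parts_sum]

theorem zMult_eq (lam : Multiset ℕ) :
    zMult lam = lam.prod * ∏ i ∈ lam.toFinset, (lam.count i).factorial := by
  rw [zMult, Finset.prod_mul_distrib, Finset.prod_multiset_count]

theorem card_class {n : ℕ} (lam : Nat.Partition n) :
    (Finset.univ.filter (fun g : Equiv.Perm (Fin n) => cycM g = lam.parts)).card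
      * zMult lam.parts = n.factorial := by
  simp_rw [cycM_eq_iff]
  have h := Equiv.Perm.card_of_cycleType_mul_eq (Fin n) (lam.parts.filter (2 ≤ ·))
  have h2 : lam.parts.filter (fun i => ¬ 2 ≤ i) = Multiset.replicate
      (Multiset.card (lam.parts.filter (fun i => ¬ 2 ≤ i))) 1 := by
    rw [Multiset.eq_replicate]
    refine ⟨rfl, fun b hb => ?_⟩
    rw [Multiset.mem_filter] at hb
    have := lam.parts_pos hb.1
    omega
  have h3 := Multiset.filter_add_not (2 ≤ ·) lam.parts
  set k := Multiset.card (lam.parts.filter (fun i => ¬ 2 ≤ i)) with hk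
  set m := lam.parts.filter (2 ≤ ·) with hm
  rw [h2] at h3
  have h4 : m.sum + k = n := by
    have := lam.parts_sum
    rw [← h3] at this
    simpa using this
  rw [if_pos ⟨by simp; omega, fun a ha => (Multiset.mem_filter.1 ha).2⟩] at h
  rw [Fintype.card_fin] at h
  have h5 : n - m.sum = k := by omega
  rw [h5] at h
  rw [← h]
  congr 1
  rw [zMult_eq, ← h3]
  have h6 : 1 ∉ m := by simp [hm]
  have h7 : ∏ i ∈ (m + Multiset.replicate k 1).toFinset,
      ((m + Multiset.replicate k 1).count i).factorial =
      ∏ i ∈ insert 1 m.toFinset,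
      ((m + Multiset.replicate k 1).count i).factorial := by
    apply Finset.prod_subset
    · intro i hi
      simp only [Multiset.mem_toFinset, Multiset.mem_add, Finset.mem_insert] at hi ⊢
      rcases hi with hi | hi
      · exact Or.inr hi
      · exact Or.inl (Multiset.eq_of_mem_replicate hi)
    · intro i _ hi
      rw [Multiset.mem_toFinset] at hi
      rw [Multiset.count_eq_zero_of_notMem hi]; rfl
  rw [h7, Finset.prod_insert (by simpa using h6)]
  have h8 : ∏ i ∈ m.toFinset, ((m + Multiset.replicate k 1).count i).factorial
      = ∏ i ∈ m.toFinset, (m.count i).factorial := by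
    apply Finset.prod_congr rfl
    intro i hi
    have : i ≠ 1 := by rintro rfl; exact h6 (by simpa using hi)
    rw [Multiset.count_add, Multiset.count_replicate, if_neg (Ne.symm this), add_zero]
  rw [h8, Multiset.count_add, Multiset.count_eq_zero_of_notMem h6]
  simp
  ring

theorem ct_sigma {η : Type*} [Fintype η] [DecidableEq η] (ws : η → ℕ)
    (g : ∀ i, Equiv.Perm (Fin (ws i))) :
    Equiv.Perm.cycleType (Equiv.Perm.sigmaCongrRight g) = ∑ i, (g i).cycleType := by
  have key : ∀ s : Finset η,
      Equiv.Perm.cycleType (Equiv.Perm.sigmaCongrRight (fun i => if i ∈ s then g i else 1))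
       = ∑ i ∈ s, (g i).cycleType := by
    intro s
    induction s using Finset.induction_on with
    | empty =>
      have : (Equiv.Perm.sigmaCongrRight (fun i => if i ∈ (∅ : Finset η) then g i else 1)) = 1 := by
        apply Equiv.ext
        rintro ⟨i, x⟩
        simp
      rw [this]; simp
    | insert a s ha ih =>
      rw [Finset.sum_insert ha, ← ih,
        ← Equiv.Perm.cycleType_extendDomain (Equiv.sigmaSubtype (β := fun i => Fin (ws i)) a).symm
          (g := g a), ← Equiv.Perm.Disjoint.cycleType_mul]
      · congr 1
        apply Equiv.ext
        rintro ⟨i, x⟩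
        by_cases hi : i = a
        · subst hi
          rw [Equiv.Perm.mul_apply]
          simp only [Equiv.Perm.sigmaCongrRight, Equiv.sigmaCongrRight_apply, ha,
            Finset.mem_insert_self, if_true, if_false, Equiv.Perm.coe_one, id]
          exact (Equiv.Perm.extendDomain_apply_subtype (g i)
            (Equiv.sigmaSubtype (β := fun i => Fin (ws i)) i).symm (b := ⟨i, x⟩) rfl).symm
        · rw [Equiv.Perm.mul_apply, Equiv.Perm.extendDomain_apply_not_subtype]
          · simp [Equiv.Perm.sigmaCongrRight, Equiv.sigmaCongrRight_apply, hi]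
          · simpa using hi
      · rintro ⟨i, x⟩
        by_cases hi : i = a
        · right
          subst hi
          simp [ha]
        · left
          rw [Equiv.Perm.extendDomain_apply_not_subtype]
          simpa using hi
  have := key Finset.univ
  simpa using this

theorem cycM_iota {η : Type*} [Fintype η] (ws : η → ℕ) {w : ℕ} (h : ∑ i, ws i = w)
    (g : ∀ i, Equiv.Perm (Fin (ws i))) :
    cycM ((embSigma ws h).symm.trans
        ((Equiv.sigmaCongrRight (fun i => (g i : Fin (ws i) ≃ Fin (ws i)))).trans
          (embSigma ws h)) : Equiv.Perm (Fin w)) = ∑ i, cycM (g i) := by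
  have h1 : Equiv.Perm.cycleType ((embSigma ws h).symm.trans
        ((Equiv.sigmaCongrRight (fun i => (g i : Fin (ws i) ≃ Fin (ws i)))).trans
          (embSigma ws h)) : Equiv.Perm (Fin w)) = ∑ i, (g i).cycleType := by
    rw [← ct_sigma]
    exact ct_permCongr (embSigma ws h) (Equiv.Perm.sigmaCongrRight g)
  have h2 : ∀ s : Finset η, ∑ i ∈ s, Multiset.replicate (ws i - (g i).support.card) 1 =
      Multiset.replicate (∑ i ∈ s, (ws i - (g i).support.card)) 1 := by
    intro s
    induction s using Finset.induction_on with
    | empty => simp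
    | insert a s ha ih => rw [Finset.sum_insert ha, Finset.sum_insert ha, ih, Multiset.replicate_add]
  unfold cycM
  rw [← Equiv.Perm.sum_cycleType, h1, Finset.sum_add_distrib, h2]
  congr 2
  have h3 : ∀ i, (g i).support.card ≤ ws i := fun i => by
    simpa using (g i).support.card_le_univ
  rw [Finset.sum_tsub_distrib _ (fun i _ => h3 i), h]
  congr 1
  have : ∀ s : Finset η, (∑ i ∈ s, (g i).cycleType).sum = ∑ i ∈ s, (g i).support.card := by
    intro s
    induction s using Finset.induction_on with
    | empty => simp
    | insert a s ha ih => rw [Finset.sum_insert ha, Finset.sum_insert ha, Multiset.sum_add, ih,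
        Equiv.Perm.sum_cycleType]
  exact this _

theorem classFun_eq {n : ℕ} {f : Equiv.Perm (Fin n) → ℚ} (hf : f ∈ classFunSub n)
    {g h : Equiv.Perm (Fin n)} (e : cycM g = cycM h) : f g = f h := by
  obtain ⟨c, hc⟩ := isConj_iff.1 (isConj_of_cycM e)
  rw [← hc]
  exact (hf c g).symm

/-- Value of a class function at a given cycle type. -/
def cval {n : ℕ} (f : Equiv.Perm (Fin n) → ℚ) (m : Multiset ℕ) : ℚ :=
  if h : ∃ g : Equiv.Perm (Fin n), cycM g = m then f h.choose else 0

theorem cval_cycM {n : ℕ} {f : Equiv.Perm (Fin n) → ℚ} (hf : f ∈ classFunSub n)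
    (g : Equiv.Perm (Fin n)) : cval f (cycM g) = f g := by
  have h : ∃ g' : Equiv.Perm (Fin n), cycM g' = cycM g := ⟨g, rfl⟩
  rw [cval, dif_pos h]
  exact classFun_eq hf h.choose_spec

theorem cval_zero {n : ℕ} (f : Equiv.Perm (Fin n) → ℚ) {m : Multiset ℕ} (h : m.sum ≠ n) :
    cval f m = 0 := by
  rw [cval, dif_neg]
  rintro ⟨g, rfl⟩
  exact h (sum_cycM g)

theorem frob {H G : Type*} [Fintype H] [Fintype G] [Group G] (ι : H → G) (φ : H → ℚ)
    (f : G → ℚ) (hf : ∀ x g, f (x * g * x⁻¹) = f g) (hi : ∀ g, f g⁻¹ = f g) :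
    sp f (IndFun ι φ) = (Fintype.card H : ℚ)⁻¹ * ∑ k, f (ι k) * φ k := by
  have h1 : ∀ x : G, ∑ g, ∑ k, f g * (if ι k = x * g⁻¹ * x⁻¹ then φ k else 0)
      = ∑ k, f (ι k) * φ k := by
    intro x
    rw [Finset.sum_comm]
    apply Finset.sum_congr rfl
    intro k _
    rw [Finset.sum_eq_single (x⁻¹ * (ι k)⁻¹ * x)]
    · rw [if_pos (by group)]
      congr 1
      have := hf x⁻¹ (ι k)⁻¹
      rw [inv_inv] at this
      rw [this, hi]
    · intro b _ hb
      rw [if_neg, mul_zero]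
      intro hk
      apply hb
      rw [hk]; group
    · simp
  have h2 : ∑ g, f g * ((Fintype.card H : ℚ)⁻¹ *
        ∑ x : G, ∑ k, if ι k = x * g⁻¹ * x⁻¹ then φ k else 0)
      = (Fintype.card H : ℚ)⁻¹ *
        ∑ x : G, ∑ g, ∑ k, f g * (if ι k = x * g⁻¹ * x⁻¹ then φ k else 0) := by
    rw [Finset.sum_comm (s := (Finset.univ : Finset G)), Finset.mul_sum]
    apply Finset.sum_congr rfl
    intro g _
    simp_rw [Finset.mul_sum]
    apply Finset.sum_congr rfl
    intro x _
    apply Finset.sum_congr rfl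
    intro k _
    ring
  simp only [sp, IndFun]
  rw [h2]
  simp_rw [h1]
  rw [Finset.sum_const, Finset.card_univ, nsmul_eq_mul]
  have h5 : (Fintype.card G : ℚ) ≠ 0 := by
    exact_mod_cast Fintype.card_ne_zero
  field_simp

theorem card_class_q {n : ℕ} (lam : Nat.Partition n) :
    ((Finset.univ.filter (fun g : Equiv.Perm (Fin n) => cycM g = lam.parts)).card : ℚ)
      = (n.factorial : ℚ) * (zMult lam.parts : ℚ)⁻¹ := by
  have h := card_class lam
  have h0 : zMult lam.parts ≠ 0 := by
    intro h0
    rw [h0, mul_zero] at h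
    exact n.factorial_ne_zero h.symm
  rw [← h]
  push_cast
  have : (zMult lam.parts : ℚ) ≠ 0 := by exact_mod_cast h0
  field_simp

theorem pair_core {η : Type*} [Fintype η] (ws : η → ℕ) {w : ℕ} (h : ∑ i, ws i = w)
    (nu : ∀ i, Nat.Partition (ws i)) (c : η → ℚ) {f : Equiv.Perm (Fin w) → ℚ}
    (hf : f ∈ classFunSub w) :
    sp f (multiProdCF ws h (fun i g => if cycM g = (nu i).parts then c i else 0))
      = cval f (∑ i, (nu i).parts) * ∏ i, (c i * (zMult (nu i).parts : ℚ)⁻¹) := by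
  unfold multiProdCF
  rw [frob _ _ f hf (fun g => classFun_eq hf (cycM_inv g))]
  have h3 : ∀ k : ∀ i, Equiv.Perm (Fin (ws i)), f ((embSigma ws h).symm.trans
        ((Equiv.sigmaCongrRight (fun i => (k i : Fin (ws i) ≃ Fin (ws i)))).trans
          (embSigma ws h)) : Equiv.Perm (Fin w)) *
          ∏ i, (if cycM (k i) = (nu i).parts then c i else 0)
      = cval f (∑ i, (nu i).parts) * ∏ i, (if cycM (k i) = (nu i).parts then c i else 0) := by
    intro k
    by_cases hk : ∀ i, cycM (k i) = (nu i).parts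
    · rw [← cval_cycM hf, cycM_iota]
      simp_rw [hk]
    · push Not at hk
      obtain ⟨i, hi⟩ := hk
      rw [Finset.prod_eq_zero (Finset.mem_univ i) (if_neg hi)]
      simp
  rw [Finset.sum_congr rfl (fun k _ => h3 k), ← Finset.mul_sum]
  have h4 := (Finset.prod_univ_sum (fun i => (Finset.univ : Finset (Equiv.Perm (Fin (ws i)))))
      (fun i g => if cycM g = (nu i).parts then c i else 0)).symm
  rw [Fintype.piFinset_univ] at h4
  rw [h4, Fintype.card_pi]
  push_cast
  rw [mul_left_comm, ← Finset.prod_inv_distrib, ← Finset.prod_mul_distrib]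
  congr 1
  apply Finset.prod_congr rfl
  intro i _
  rw [← Finset.sum_filter, Finset.sum_const, nsmul_eq_mul, card_class_q, Fintype.card_perm,
    Fintype.card_fin]
  have : ((ws i).factorial : ℚ) ≠ 0 := by exact_mod_cast (ws i).factorial_ne_zero
  field_simp

/-- Underlying multiset of natural numbers. -/
def coeM (m : Multiset ℕ+) : Multiset ℕ := Multiset.map PNat.val m

theorem coeM_add (m m' : Multiset ℕ+) : coeM (m + m') = coeM m + coeM m' :=
  Multiset.map_add _ _ _

theorem coeM_inj : Function.Injective coeM :=
  Multiset.map_injective PNat.coe_injective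

theorem coeM_sum {η : Type*} (s : Finset η) (f : η → Multiset ℕ+) :
    coeM (∑ i ∈ s, f i) = ∑ i ∈ s, coeM (f i) :=
  map_sum (Multiset.mapAddMonoidHom PNat.val) f s

/-- `z` on multisets of positive integers. -/
def zM (m : Multiset ℕ+) : ℚ := (zMult (coeM m) : ℚ)

theorem ptt_ext {a b : PttAll} (h : a.2.parts = b.2.parts) : a = b := by
  obtain ⟨n, a⟩ := a
  obtain ⟨m, b⟩ := b
  have : n = m := by rw [← a.parts_sum, ← b.parts_sum, h]
  subst this
  congr 1
  exact Nat.Partition.ext h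

theorem coeM_pmap (m : Multiset ℕ) (H : ∀ i ∈ m, 0 < i) :
    coeM (m.pmap (fun i h => (⟨i, h⟩ : ℕ+)) H) = m := by
  exact (Multiset.map_pmap PNat.val (fun i h => (⟨i, h⟩ : ℕ+)) m H).trans
    ((Multiset.pmap_eq_map _ id m H).trans (Multiset.map_id m))

/-- Partitions as multisets of positive integers. -/
def eM : PttAll ≃ Multiset ℕ+ where
  toFun a := a.2.parts.pmap (fun i h => ⟨i, h⟩) (fun _ h => a.2.parts_pos h)
  invFun m := ⟨(coeM m).sum, ⟨coeM m, by
    intro i hi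
    obtain ⟨j, _, rfl⟩ := Multiset.mem_map.1 hi
    exact j.pos, rfl⟩⟩
  left_inv a := by
    apply ptt_ext
    exact coeM_pmap _ _
  right_inv m := by
    apply coeM_inj
    exact coeM_pmap _ _

theorem coeM_eM (a : PttAll) : coeM (eM a) = a.2.parts :=
  coeM_pmap _ _

theorem card_eM (a : PttAll) : Multiset.card (eM a) = Multiset.card a.2.parts := by
  rw [← coeM_eM, coeM, Multiset.card_map]

/-- Value of the class function labelled by `a` at cycle type `m`. -/
def ub (u : ∀ n : ℕ, Nat.Partition n → Equiv.Perm (Fin n) → ℚ) (a : PttAll)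
    (m : Multiset ℕ+) : ℚ := cval (u a.1 a.2) (coeM m)

theorem ub_zero (u : ∀ n : ℕ, Nat.Partition n → Equiv.Perm (Fin n) → ℚ) (a : PttAll)
    (m : Multiset ℕ+) (h : (coeM m).sum ≠ a.1) : ub u a m = 0 := cval_zero _ h

theorem pair_gen {η : Type*} [Fintype η] 
    (u : ∀ n : ℕ, Nat.Partition n → Equiv.Perm (Fin n) → ℚ) (hu : IsGradedBasis u)
    (a : PttAll) (nu : η → PttAll) (c : η → ℚ) :
    pairCF (u a.1 a.2) (multiProdCF (fun q => (nu q).1) rfl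
      (fun q g => if cycM g = (nu q).2.parts then c q else 0))
      = ub u a (∑ q, eM (nu q)) * ∏ q, (c q * (zM (eM (nu q)))⁻¹) := by
  have hs : coeM (∑ q, eM (nu q)) = ∑ q, (nu q).2.parts := by
    rw [coeM_sum]
    simp_rw [coeM_eM]
  have hsum : (coeM (∑ q, eM (nu q))).sum = ∑ q, (nu q).1 := by
    rw [hs]
    have := map_sum (Multiset.sumAddMonoidHom : Multiset ℕ →+ ℕ) (fun q => (nu q).2.parts)
      Finset.univ
    simp only [Multiset.coe_sumAddMonoidHom] at this
    rw [this]
    simp_rw [Nat.Partition.parts_sum]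
  by_cases h : a.1 = ∑ q, (nu q).1
  · obtain ⟨n, a⟩ := a
    simp only at h
    subst h
    rw [pairCF, dif_pos rfl]
    have := pair_core (fun q => (nu q).1) rfl (fun q => (nu q).2) c ((hu _).1 a)
    simp only [ub, zM, coeM_eM, hs]
    rw [← this]
    rfl
  · rw [pairCF, dif_neg h, ub_zero, zero_mul]
    rw [hsum]; exact Ne.symm h

theorem zM_ne (m : Multiset ℕ+) : zM m ≠ 0 := by
  unfold zM
  rw [zMult]
  norm_cast
  refine Finset.prod_ne_zero_iff.2 ?_
  intro i hi
  rw [Multiset.mem_toFinset] at hi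
  obtain ⟨j, _, rfl⟩ := Multiset.mem_map.1 hi
  exact mul_ne_zero (pow_ne_zero _ j.ne_zero) (Nat.factorial_ne_zero _)

theorem pair_pt {η : Type*} [Fintype η] 
    (u : ∀ n : ℕ, Nat.Partition n → Equiv.Perm (Fin n) → ℚ) (hu : IsGradedBasis u)
    (a : PttAll) (nu : η → PttAll) :
    pairCF (u a.1 a.2) (multiProdCF (fun q => (nu q).1) rfl (fun q => ptFun (nu q).2))
      = ub u a (∑ q, eM (nu q)) * ∏ q, (zM (eM (nu q)))⁻¹ := by
  have := pair_gen u hu a nu (fun _ => 1)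
  simp only [one_mul] at this
  rw [← this]
  rfl

theorem pair_p {η : Type*} [Fintype η] 
    (u : ∀ n : ℕ, Nat.Partition n → Equiv.Perm (Fin n) → ℚ) (hu : IsGradedBasis u)
    (a : PttAll) (nu : η → PttAll) :
    pairCF (u a.1 a.2) (multiProdCF (fun q => (nu q).1) rfl (fun q => pFun (nu q).2))
      = ub u a (∑ q, eM (nu q)) := by
  have := pair_gen u hu a nu (fun q => zM (eM (nu q)))
  rw [Finset.prod_congr rfl (fun q _ => mul_inv_cancel₀ (zM_ne (eM (nu q)))),
    Finset.prod_const_one, mul_one] at this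
  rw [← this]
  simp only [zM, coeM_eM]
  rfl

theorem dual_fin (u v : ∀ n : ℕ, Nat.Partition n → Equiv.Perm (Fin n) → ℚ)
    (hu : IsGradedBasis u) (hv : IsGradedBasis v) (hd : IsDualPair u v)
    (n : ℕ) (b c : Nat.Partition n) :
    ∑ a : Nat.Partition n, ub v ⟨n, a⟩ (eM ⟨n, b⟩) * (zM (eM ⟨n, b⟩))⁻¹ *
      ub u ⟨n, a⟩ (eM ⟨n, c⟩) = if b = c then 1 else 0 := by
  set U : Matrix (Nat.Partition n) (Nat.Partition n) ℚ :=
    Matrix.of fun a b => ub u ⟨n, a⟩ (eM ⟨n, b⟩) with hU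
  set V : Matrix (Nat.Partition n) (Nat.Partition n) ℚ :=
    Matrix.of fun b a => ub v ⟨n, a⟩ (eM ⟨n, b⟩) * (zM (eM ⟨n, b⟩))⁻¹ with hV
  have h1 : U * V = 1 := by
    ext a a'
    rw [Matrix.one_apply, ← hd n a a', Matrix.mul_apply]
    simp only [hU, hV, Matrix.of_apply, sp]
    have h2 : ∀ g : Equiv.Perm (Fin n), ∃ b : Nat.Partition n, cycM g = b.parts := fun g =>
      ⟨⟨cycM g, fun h => pos_cycM g h, sum_cycM g⟩, rfl⟩
    choose B hB using h2
    rw [← Finset.sum_fiberwise Finset.univ B, Finset.mul_sum]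
    apply Finset.sum_congr rfl
    intro b _
    have h3 : ∀ g ∈ Finset.univ.filter (fun g => B g = b), u n a g * v n a' g⁻¹ =
        ub u ⟨n, a⟩ (eM ⟨n, b⟩) * ub v ⟨n, a'⟩ (eM ⟨n, b⟩) := by
      intro g hg
      rw [Finset.mem_filter] at hg
      simp only [ub, coeM_eM]
      rw [← hg.2, ← hB, cval_cycM ((hu n).1 a), cval_cycM ((hv n).1 a'),
        classFun_eq ((hv n).1 a') (cycM_inv g)]
    rw [Finset.sum_congr rfl h3, Finset.sum_const, nsmul_eq_mul]
    have h4 : Finset.univ.filter (fun g => B g = b) =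
        Finset.univ.filter (fun g : Equiv.Perm (Fin n) => cycM g = b.parts) := by
      apply Finset.filter_congr
      intro g _
      rw [hB, Nat.Partition.ext_iff]
    rw [h4, card_class_q, Fintype.card_perm, Fintype.card_fin]
    have : (n.factorial : ℚ) ≠ 0 := by exact_mod_cast n.factorial_ne_zero
    simp only [zM, coeM_eM]
    field_simp
  have h5 := mul_eq_one_comm.1 h1
  have h6 := congrFun (congrFun h5 b) c
  rw [Matrix.mul_apply, Matrix.one_apply] at h6
  exact h6

/-- Families of multisets with sum `b`. -/
def Dset (T : Type*) [Fintype T] (b : Multiset ℕ+) : Finset (T → Multiset ℕ+) :=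
  (Fintype.piFinset (fun _ : T => b.powerset.toFinset)).filter (fun k => ∑ t, k t = b)

theorem mem_Dset {T : Type*} [Fintype T] (b : Multiset ℕ+) (k : T → Multiset ℕ+) :
    k ∈ Dset T b ↔ ∑ t, k t = b := by
  simp only [Dset, Finset.mem_filter, Fintype.mem_piFinset, Multiset.mem_toFinset,
    Multiset.mem_powerset, and_iff_right_iff_imp]
  rintro rfl t
  exact Finset.single_le_sum (f := k) (fun _ _ => Multiset.zero_le _) (Finset.mem_univ t)

theorem zM_eq (m : Multiset ℕ+) (s : Finset ℕ+) (hs : m.toFinset ⊆ s) :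
    zM m = ∏ i ∈ s, ((i : ℚ) ^ m.count i * (m.count i).factorial) := by
  have h1 : zM m = ∏ i ∈ m.toFinset, ((i : ℚ) ^ m.count i * (m.count i).factorial) := by
    unfold zM zMult
    have : (coeM m).toFinset = m.toFinset.image (fun i : ℕ+ => (i : ℕ)) := by
      ext i; simp [coeM]
    rw [this, Finset.prod_image (fun _ _ _ _ h => PNat.coe_injective h)]
    push_cast
    apply Finset.prod_congr rfl
    intro i _
    have : (coeM m).count (i : ℕ) = m.count i :=
      Multiset.count_map_eq_count' _ _ PNat.coe_injective _
    rw [this]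
  rw [h1]
  apply Finset.prod_subset hs
  intro i _ hi
  rw [Multiset.mem_toFinset] at hi
  rw [Multiset.count_eq_zero_of_notMem hi]
  simp

theorem prod_eq {R : Type*} [CommRing R] (f : ℕ+ → R) (m : Multiset ℕ+) (s : Finset ℕ+)
    (hs : m.toFinset ⊆ s) :
    (m.map f).prod = ∏ i ∈ s, f i ^ m.count i := by
  rw [Finset.prod_multiset_map_count]
  apply Finset.prod_subset hs
  intro i _ hi
  rw [Multiset.mem_toFinset] at hi
  rw [Multiset.count_eq_zero_of_notMem hi]
  simp

theorem expand {T R : Type*} [Fintype T] [CommRing R] [Algebra ℚ R] (X : T → ℕ+ → R)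
    (b : Multiset ℕ+) :
    (zM b)⁻¹ • (b.map (fun i => ∑ t, X t i)).prod =
      ∑ k ∈ Dset T b, ∏ t, (zM (k t))⁻¹ • ((k t).map (X t)).prod := by
  set s := b.toFinset with hs
  -- one part size
  have h1 : ∀ i : ℕ+, ((i : ℚ) ^ b.count i * (b.count i).factorial)⁻¹ •
      (∑ t, X t i) ^ b.count i = ∑ n ∈ Finset.piAntidiag Finset.univ (b.count i),
        ∏ t, ((i : ℚ) ^ n t * (n t).factorial)⁻¹ • (X t i) ^ (n t) := by
    intro i
    rw [Finset.sum_pow_eq_sum_piAntidiag, Finset.smul_sum]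
    apply Finset.sum_congr rfl
    intro n hn
    rw [Finset.mem_piAntidiag] at hn
    have h2 := Nat.multinomial_spec Finset.univ n
    rw [hn.1] at h2
    have hi : (i : ℚ) ≠ 0 := by exact_mod_cast i.ne_zero
    have hm : ((Nat.multinomial Finset.univ n : ℕ) : R) =
        algebraMap ℚ R (Nat.multinomial Finset.univ n : ℕ) := by simp
    rw [hm, ← Algebra.smul_def, smul_smul, Finset.prod_smul]
    congr 1
    rw [Finset.prod_inv_distrib, Finset.prod_mul_distrib, Finset.prod_pow_eq_pow_sum, hn.1, ← h2]
    push_cast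
    have h3 : (∏ t, ((n t).factorial : ℚ)) ≠ 0 :=
      Finset.prod_ne_zero_iff.2 (fun t _ => by exact_mod_cast (n t).factorial_ne_zero)
    have h4 : ((Nat.multinomial Finset.univ n : ℕ) : ℚ) ≠ 0 := by
      intro h0
      have h0' : Nat.multinomial Finset.univ n = 0 := by exact_mod_cast h0
      rw [h0', mul_zero] at h2
      exact (Nat.factorial_ne_zero _) h2.symm
    field_simp
  rw [zM_eq b s subset_rfl, prod_eq _ b s subset_rfl, ← Finset.prod_inv_distrib,
    ← Finset.prod_smul, Finset.prod_congr rfl (fun i _ => h1 i), ← Finset.prod_coe_sort,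
    Finset.prod_univ_sum]
  have hcount : ∀ (p : s → T → ℕ) (t : T) (i : s),
      Multiset.count i.1 (∑ j : s, p j t • ({j.1} : Multiset ℕ+)) = p i t := by
    intro p t i
    rw [Multiset.count_sum']
    rw [Finset.sum_eq_single i]
    · simp
    · intro j _ hj
      rw [Multiset.count_nsmul, Multiset.count_singleton, if_neg, mul_zero]
      intro h; exact hj (Subtype.ext h.symm)
    · simp
  have hsub : ∀ (p : s → T → ℕ) (t : T),
      (∑ j : s, p j t • ({j.1} : Multiset ℕ+)).toFinset ⊆ s := by
    intro p t i hi
    rw [Multiset.mem_toFinset, Multiset.mem_sum] at hi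
    obtain ⟨j, _, hj⟩ := hi
    have := Multiset.mem_of_mem_nsmul hj
    rw [Multiset.mem_singleton] at this
    rw [this]; exact j.2
  have hsub2 : ∀ k ∈ Dset T b, ∀ t, (k t).toFinset ⊆ s := by
    intro k hk t
    rw [mem_Dset] at hk
    apply Multiset.toFinset_subset.2
    apply Multiset.subset_of_le
    rw [← hk]
    exact Finset.single_le_sum (f := k) (fun _ _ => Multiset.zero_le _) (Finset.mem_univ t)
  refine Finset.sum_bij' (fun p _ t => ∑ j : s, p j t • ({j.1} : Multiset ℕ+))
    (fun k _ i t => (k t).count i.1) ?_ ?_ ?_ ?_ ?_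
  · intro p hp
    rw [mem_Dset]
    rw [Fintype.mem_piFinset] at hp
    ext i
    rw [Multiset.count_sum']
    by_cases hi : i ∈ s
    · rw [Finset.sum_congr rfl (fun t _ => hcount p t ⟨i, hi⟩)]
      exact (Finset.mem_piAntidiag.1 (hp ⟨i, hi⟩)).1
    · rw [Finset.sum_eq_zero, Multiset.count_eq_zero_of_notMem (by simpa [hs] using hi)]
      intro t _
      rw [Multiset.count_eq_zero]
      intro h
      exact hi (hsub p t (Multiset.mem_toFinset.2 h))
  · intro k hk
    rw [Fintype.mem_piFinset]
    intro i
    rw [Finset.mem_piAntidiag]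
    refine ⟨?_, fun t _ => Finset.mem_univ t⟩
    rw [mem_Dset] at hk
    rw [← hk, Multiset.count_sum']
  · intro p hp
    funext i t
    exact hcount p t i
  · intro k hk
    funext t
    ext i
    by_cases hi : i ∈ s
    · exact hcount (fun i t => (k t).count i.1) t ⟨i, hi⟩
    · rw [Multiset.count_eq_zero_of_notMem, Multiset.count_eq_zero_of_notMem]
      · intro h; exact hi (hsub2 k hk t (Multiset.mem_toFinset.2 h))
      · intro h; exact hi (hsub (fun i t => (k t).count i.1) t (Multiset.mem_toFinset.2 h))
  · intro p hp
    rw [Finset.prod_comm]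
    apply Finset.prod_congr rfl
    intro t _
    rw [zM_eq _ s (hsub p t), prod_eq _ _ s (hsub p t), ← Finset.prod_inv_distrib,
      ← Finset.prod_smul, ← Finset.prod_coe_sort s]
    apply Finset.prod_congr rfl
    intro i _
    rw [hcount]

/-- The algebra with basis the maps from `T` to partitions. -/
abbrev Alg (T : Type*) : Type _ := AddMonoidAlgebra ℚ (T → Multiset ℕ+)

/-- The basis element supported at `t`. -/
def gen {T : Type*} (t : T) (m : Multiset ℕ+) : Alg T :=
  AddMonoidAlgebra.single (Pi.single t m) 1

theorem gen_add {T : Type*} (t : T) (m m' : Multiset ℕ+) :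
    gen t (m + m') = gen t m * gen t m' := by
  simp [gen, Pi.single_add, AddMonoidAlgebra.single_mul_single]

theorem gen_zero {T : Type*} (t : T) : gen t 0 = 1 := by
  simp [gen, AddMonoidAlgebra.one_def]

theorem gen_sum {T η : Type*} (t : T) (s : Finset η) (f : η → Multiset ℕ+) :
    gen t (∑ i ∈ s, f i) = ∏ i ∈ s, gen t (f i) := by
  induction s using Finset.induction_on with
  | empty => simp [gen_zero]
  | insert a s ha ih => rw [Finset.sum_insert ha, Finset.prod_insert ha, gen_add, ih]

theorem prod_gen {T : Type*} [Fintype T] (f : T → Multiset ℕ+) :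
    ∏ t, gen t (f t) = AddMonoidAlgebra.single f 1 := by
  have h : ∀ s : Finset T, ∏ t ∈ s, gen t (f t) =
      AddMonoidAlgebra.single (∑ t ∈ s, Pi.single t (f t)) (1 : ℚ) := by
    intro s
    induction s using Finset.induction_on with
    | empty => simp [AddMonoidAlgebra.one_def]
    | insert a s ha ih => 
      rw [Finset.sum_insert ha, Finset.prod_insert ha, ih, gen,
        AddMonoidAlgebra.single_mul_single, one_mul]
  rw [h, Finset.univ_sum_single]

theorem gen_prod {T : Type*} (t : T) (c : ℚ) (m : Multiset ℕ+) :
    (m.map (fun i => c • gen t {i})).prod = c ^ (Multiset.card m) • gen t m := by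
  induction m using Multiset.induction_on with
  | empty => simp [gen_zero]
  | cons a m ih =>
    rw [Multiset.map_cons, Multiset.prod_cons, ih, Multiset.card_cons, ← Multiset.singleton_add,
      gen_add, smul_mul_smul_comm, pow_succ']

/-- The substitution homomorphism attached to a matrix. -/
def SA {T Q : Type*} [Fintype T] [Fintype Q] (A : T → Q → ℚ) : Alg Q →ₐ[ℚ] Alg T :=
  AddMonoidAlgebra.lift ℚ (Alg T) (Q → Multiset ℕ+)
    { toFun := fun f => ∏ q, ((Multiplicative.toAdd f q).map
        (fun i => ∑ t, A t q • gen t {i})).prod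
      map_one' := by simp
      map_mul' := by
        intro f g
        simp [Finset.prod_mul_distrib] }

theorem SA_single {T Q : Type*} [Fintype T] [Fintype Q] (A : T → Q → ℚ)
    (f : Q → Multiset ℕ+) (c : ℚ) : SA A (AddMonoidAlgebra.single f c) =
      c • ∏ q, ((f q).map (fun i => ∑ t, A t q • gen t {i})).prod := by
  rw [SA, AddMonoidAlgebra.lift_single]
  rfl

theorem SA_gen {T Q : Type*} [Fintype T] [Fintype Q] (A : T → Q → ℚ)
    (q : Q) (m : Multiset ℕ+) : SA A (gen q m) =
      (m.map (fun i => ∑ t, A t q • gen t {i})).prod := by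
  rw [gen, SA_single, one_smul, Finset.prod_eq_single q]
  · simp
  · intro b _ hb
    simp [Pi.single_eq_of_ne hb]
  · simp

theorem SA_comp {T Q Z : Type*} [Fintype T] [Fintype Q] [Fintype Z] (A : T → Q → ℚ)
    (B : Q → Z → ℚ) (x : Alg Z) :
    SA A (SA B x) = SA (fun t z => ∑ q : Q, A t q * B q z) x := by
  induction x using AddMonoidAlgebra.induction_linear with
  | zero => simp
  | add x y hx hy => simp [hx, hy]
  | single f c =>
    rw [SA_single, SA_single, map_smul, map_prod]
    congr 1
    apply Finset.prod_congr rfl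
    intro z _
    rw [map_multiset_prod, Multiset.map_map]
    congr 1
    apply Multiset.map_congr rfl
    intro i _
    simp only [Function.comp, map_sum, map_smul, SA_gen, Multiset.map_singleton,
      Multiset.prod_singleton, Finset.smul_sum, smul_smul, Finset.sum_smul]
    rw [Finset.sum_comm]
    simp_rw [mul_comm]

/-- The element of the algebra attached to a class function at position `q`. -/
def Wq {Q : Type*} (v : ∀ n : ℕ, Nat.Partition n → Equiv.Perm (Fin n) → ℚ) (q : Q)
    (a : PttAll) : Alg Q :=
  ∑ b : Nat.Partition a.1, (ub v a (eM ⟨a.1, b⟩) * (zM (eM ⟨a.1, b⟩))⁻¹) • gen q (eM ⟨a.1, b⟩)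

/-- The element of the algebra attached to a family of class functions. -/
def WW {Q : Type*} [Fintype Q] (v : ∀ n : ℕ, Nat.Partition n → Equiv.Perm (Fin n) → ℚ)
    (a : Q → PttAll) : Alg Q := ∏ q, Wq v q (a q)

/-- The evaluation functional attached to a family of class functions. -/
def Uf {T : Type*} [Fintype T] (u : ∀ n : ℕ, Nat.Partition n → Equiv.Perm (Fin n) → ℚ)
    (a : T → PttAll) : Alg T →ₗ[ℚ] ℚ :=
  (Finsupp.linearCombination ℚ (fun f : T → Multiset ℕ+ => ∏ t, ub u (a t) (f t))).comp
    (AddMonoidAlgebra.coeffLinearEquiv ℚ).toLinearMap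

theorem Uf_single {T : Type*} [Fintype T]
    (u : ∀ n : ℕ, Nat.Partition n → Equiv.Perm (Fin n) → ℚ)
    (a : T → PttAll) (f : T → Multiset ℕ+) (c : ℚ) :
    Uf u a (AddMonoidAlgebra.single f c) = c * ∏ t, ub u (a t) (f t) := by
  simp [Uf]

/-- Families of multisets with total size `n`. -/
def Eset (T : Type*) [Fintype T] (n : ℕ) : Finset (T → Multiset ℕ+) :=
  Finset.univ.biUnion (fun b : Nat.Partition n => Dset T (eM ⟨n, b⟩))

theorem mem_Eset {T : Type*} [Fintype T] {n : ℕ} {k : T → Multiset ℕ+}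
    (h : (coeM (∑ t, k t)).sum = n) : k ∈ Eset T n := by
  subst h
  rw [Eset, Finset.mem_biUnion]
  refine ⟨(eM.symm (∑ t, k t)).2, Finset.mem_univ _, ?_⟩
  rw [mem_Dset]
  exact (eM.apply_symm_apply _).symm

theorem SA_Wq {T Q : Type*} [Fintype T] [Fintype Q] (A : T → Q → ℚ)
    (v : ∀ n : ℕ, Nat.Partition n → Equiv.Perm (Fin n) → ℚ) (q : Q) (a : PttAll) :
    SA A (Wq v q a) = ∑ k ∈ Eset T a.1, (ub v a (∑ t, k t) *
      ∏ t, ((zM (k t))⁻¹ * A t q ^ Multiset.card (k t))) • ∏ t, gen t (k t) := by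
  rw [Eset, Finset.sum_biUnion, Wq, map_sum]
  · apply Finset.sum_congr rfl
    intro b _
    rw [map_smul, SA_gen, mul_smul, expand, Finset.smul_sum]
    apply Finset.sum_congr rfl
    intro k hk
    rw [mem_Dset] at hk
    rw [hk, mul_smul, ← Finset.prod_smul]
    congr 1
    apply Finset.prod_congr rfl
    intro t _
    rw [gen_prod, smul_smul]
  · intro b _ c _ hbc
    rw [Function.onFun, Finset.disjoint_left]
    intro k hk hk'
    rw [mem_Dset] at hk hk'
    rw [hk] at hk'
    have := eM.injective hk'
    apply hbc
    simpa using this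

theorem SA_WW {T Q : Type*} [Fintype T] [Fintype Q] (A : T → Q → ℚ)
    (v : ∀ n : ℕ, Nat.Partition n → Equiv.Perm (Fin n) → ℚ) (a : Q → PttAll) :
    SA A (WW v a) = ∑ K ∈ Fintype.piFinset (fun q => Eset T (a q).1),
      (∏ q, (ub v (a q) (∑ t, K q t) *
        ∏ t, ((zM (K q t))⁻¹ * A t q ^ Multiset.card (K q t)))) •
        AddMonoidAlgebra.single (fun t => ∑ q, K q t) 1 := by
  rw [WW, map_prod]
  simp_rw [SA_Wq]
  rw [Finset.prod_univ_sum]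
  apply Finset.sum_congr rfl
  intro K _
  rw [Finset.prod_smul]
  congr 1
  rw [Finset.prod_comm, ← prod_gen]
  simp_rw [gen_sum]

theorem wrGen_eq {T Q : Type*} [Fintype T] [Fintype Q]
    (u v : ∀ n : ℕ, Nat.Partition n → Equiv.Perm (Fin n) → ℚ)
    (hu : IsGradedBasis u) (hv : IsGradedBasis v)
    (A : T → Q → ℚ) (lam : T → PttAll) (mu : Q → PttAll) :
    wrGen u v A lam mu = Uf u lam (SA A (WW v mu)) := by
  rw [SA_WW, map_sum]
  simp_rw [map_smul, Uf_single, one_mul, smul_eq_mul]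
  set F : (Q → T → Multiset ℕ+) → ℚ := fun K => (∏ q, (ub v (mu q) (∑ t, K q t) *
        ∏ t, ((zM (K q t))⁻¹ * A t q ^ Multiset.card (K q t)))) *
        ∏ t, ub u (lam t) (∑ q, K q t) with hF
  have h1 : ∑ᶠ K, F K = ∑ K ∈ Fintype.piFinset (fun q => Eset T (mu q).1), F K := by
    apply finsum_eq_sum_of_support_subset
    intro K hK
    rw [Finset.mem_coe, Fintype.mem_piFinset]
    intro q
    apply mem_Eset
    by_contra h
    apply hK
    simp only [hF]
    rw [Finset.prod_eq_zero (Finset.mem_univ q), zero_mul]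
    rw [ub_zero _ _ _ h, zero_mul]
  rw [← h1]
  let e : (T × Q → PttAll) ≃ (Q → T → Multiset ℕ+) :=
    { toFun := fun nu q t => eM (nu (t, q))
      invFun := fun K p => eM.symm (K p.2 p.1)
      left_inv := fun nu => by funext p; simp
      right_inv := fun K => by funext q t; simp }
  rw [← finsum_comp_equiv e]
  unfold wrGen
  apply finsum_congr
  intro nu
  have e1 : ∀ q t, e nu q t = eM (nu (t, q)) := fun _ _ => rfl
  simp only [hF, e1]
  rw [Finset.prod_congr rfl (fun t _ => pair_pt u hu (lam t) (fun q => nu (t, q))),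
    Finset.prod_congr rfl (fun q _ => pair_p v hv (mu q) (fun t => nu (t, q)))]
  simp only [Finset.prod_mul_distrib, card_eM]
  rw [Finset.prod_comm (f := fun q t => (zM (eM (nu (t, q))))⁻¹),
    Finset.prod_comm (f := fun q t => A t q ^ _)]
  ring

theorem repro {Q : Type*} [Fintype Q]
    (u v : ∀ n : ℕ, Nat.Partition n → Equiv.Perm (Fin n) → ℚ)
    (hu : IsGradedBasis u) (hv : IsGradedBasis v) (hd : IsDualPair u v)
    (L : Alg Q →ₗ[ℚ] ℚ) (x : Alg Q) :
    (Function.support (fun mu : Q → PttAll => L (WW v mu) * Uf u mu x)).Finite ∧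
      ∑ᶠ mu : Q → PttAll, L (WW v mu) * Uf u mu x = L x := by
  induction x using AddMonoidAlgebra.induction_linear with
  | zero => simp
  | add x y hx hy =>
    simp only [map_add, mul_add]
    refine ⟨(hx.1.union hy.1).subset (Function.support_add _ _), ?_⟩
    rw [finsum_add_distrib hx.1 hy.1, hx.2, hy.2]
  | single f c =>
    set n : Q → ℕ := fun q => (coeM (f q)).sum with hn
    let ι : (∀ q, Nat.Partition (n q)) → (Q → PttAll) := fun m q => ⟨n q, m q⟩
    have hinj : Function.Injective ι := by
      intro m m' h
      funext q
      have := congrFun h q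
      simpa [ι] using this
    set S : Finset (Q → PttAll) := Finset.univ.image ι with hS
    have hsup : (Function.support (fun mu : Q → PttAll => L (WW v mu) *
        Uf u mu (AddMonoidAlgebra.single f c))) ⊆ S := by
      intro mu hmu
      have h1 : ∀ q, n q = (mu q).1 := by
        intro q
        by_contra h
        apply hmu
        simp only [Uf_single]
        rw [Finset.prod_eq_zero (Finset.mem_univ q) (ub_zero u _ _ h)]
        simp
      rw [hS, Finset.coe_image]
      refine ⟨fun q => ⟨(mu q).2.parts, (mu q).2.parts_pos, ?_⟩, by simp, ?_⟩
      · rw [h1, (mu q).2.parts_sum]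
      · funext q
        exact ptt_ext rfl
    refine ⟨S.finite_toSet.subset hsup, ?_⟩
    rw [finsum_eq_sum_of_support_subset _ hsup, hS, Finset.sum_image (fun _ _ _ _ h => hinj h)]
    have hf : ∀ q, ∃ b : Nat.Partition (n q), eM ⟨n q, b⟩ = f q := fun q =>
      ⟨(eM.symm (f q)).2, eM.apply_symm_apply (f q)⟩
    choose b hb using hf
    have key : ∑ m : ∀ q, Nat.Partition (n q), (∏ q, ub u (ι m q) (f q)) • WW v (ι m)
        = AddMonoidAlgebra.single f 1 := by
      simp only [WW]
      simp_rw [← Finset.prod_smul]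
      have h4 := (Finset.prod_univ_sum
        (fun q => (Finset.univ : Finset (Nat.Partition (n q))))
        (fun q m => ub u ⟨n q, m⟩ (f q) • Wq v q ⟨n q, m⟩)).symm
      rw [Fintype.piFinset_univ] at h4
      rw [h4, ← prod_gen]
      apply Finset.prod_congr rfl
      intro q _
      have hW : ∀ m : Nat.Partition (n q), Wq v q ⟨n q, m⟩ = ∑ b : Nat.Partition (n q),
        (ub v ⟨n q, m⟩ (eM ⟨n q, b⟩) * (zM (eM ⟨n q, b⟩))⁻¹) • gen q (eM ⟨n q, b⟩) :=
        fun _ => rfl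
      simp only [hW, Finset.smul_sum, smul_smul]
      rw [Finset.sum_comm]
      simp_rw [← Finset.sum_smul]
      rw [Finset.sum_eq_single (b q)]
      · have := dual_fin u v hu hv hd (n q) (b q) (b q)
        rw [if_pos rfl] at this
        rw [← hb q]
        simp_rw [mul_comm (ub u _ _)]
        rw [this, one_smul]
      · intro c _ hc
        have := dual_fin u v hu hv hd (n q) c (b q)
        rw [if_neg hc] at this
        rw [← hb q]
        simp_rw [mul_comm (ub u _ _)]
        rw [this, zero_smul]
      · simp
    have h5 : AddMonoidAlgebra.single f c = c • AddMonoidAlgebra.single f (1 : ℚ) := by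
      simp
    have h6 : L (AddMonoidAlgebra.single f c) =
        c * ∑ m, (∏ q, ub u (ι m q) (f q)) * L (WW v (ι m)) := by
      rw [h5, map_smul, ← key, map_sum, smul_eq_mul]
      simp_rw [map_smul, smul_eq_mul]
    rw [h6, Finset.mul_sum]
    apply Finset.sum_congr rfl
    intro m _
    rw [Uf_single]
    ring

/-- **Proposition 3.9.** Let `(u, v)` be a dual pair of graded bases of `Λ_ℚ`, `A` a
`T × Q`-matrix and `B` a `Q × Z`-matrix. Then `(AB)^{≀}(u,v) = A^{≀}(u,v) · B^{≀}(u,v)`. -/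
theorem wr_mul {T Q Z : Type*} [Fintype T] [Fintype Q] [Fintype Z]
    (u v : ∀ n : ℕ, Nat.Partition n → Equiv.Perm (Fin n) → ℚ)
    (hu : IsGradedBasis u) (hv : IsGradedBasis v) (hd : IsDualPair u v)
    (A : T → Q → ℚ) (B : Q → Z → ℚ)
    (lam : T → PttAll) (nu : Z → PttAll) :
    wrGen u v (fun t z => ∑ q : Q, A t q * B q z) lam nu
      = ∑ᶠ mu : Q → PttAll, wrGen u v A lam mu * wrGen u v B mu nu := by
  rw [wrGen_eq u v hu hv, ← SA_comp]
  have h := (repro u v hu hv hd ((Uf u lam).comp (SA A).toLinearMap)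
    (SA B (WW v nu))).2
  simp only [wrGen_eq u v hu hv]
  exact h.symm

end
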